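/- Let β, β′ ∈ ℬ be distinct, and suppose that neither C(β) is a subchain of C(β′) nor C(β′) is a subchain of C(β). Then Δ(β) and Δ(β′) are totally disjoint, i.e. every root of Δ(β) is strongly orthogonal to every root of Δ(β′); in particular β and β′ are strongly orthogonal. -/

import Mathlib

open scoped InnerProductSpace BigOperators

structure RootSystemData (V : Type*) [NormedAddCommGroup V] [InnerProductSpace ℝ V] where
  Δ : Set V
  finite : Δ.Finite
  span_top : Submodule.span ℝ Δ = ⊤
  zero_not_mem : (0 : V) ∉ Δ
  neg_mem : ∀ α ∈ Δ, -α ∈ Δ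
  reduced : ∀ α ∈ Δ, ∀ t : ℝ, t • α ∈ Δ → t = 1 ∨ t = -1
  crystal : ∀ α ∈ Δ, ∀ β ∈ Δ, ∃ n : ℤ, 2 * ⟪α, β⟫_ℝ = (n : ℝ) * ⟪β, β⟫_ℝ
  reflect_mem : ∀ α ∈ Δ, ∀ β ∈ Δ, α - (2 * ⟪α, β⟫_ℝ / ⟪β, β⟫_ℝ) • β ∈ Δ
  Pos : Set V
  pos_subset : Pos ⊆ Δ
  mem_or_neg : ∀ α ∈ Δ, α ∈ Pos ∨ -α ∈ Pos
  not_neg_mem : ∀ α ∈ Pos, -α ∉ Pos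
  pos_add : ∀ α ∈ Pos, ∀ β ∈ Pos, α + β ∈ Δ → α + β ∈ Pos

namespace RootSystemData

variable {V : Type*} [NormedAddCommGroup V] [InnerProductSpace ℝ V] (R : RootSystemData V)

/-- The set of simple roots: indecomposable positive roots. -/
def Simple : Set V := {α ∈ R.Pos | ¬ ∃ β ∈ R.Pos, ∃ γ ∈ R.Pos, α = β + γ}

/-- The support `Π(φ)` of a positive root: the simple roots needed to express `φ`. -/
def support (φ : V) : Set V := {α ∈ R.Simple | φ ∉ Submodule.span ℝ (R.Simple \ {α})}

/-- The root subsystem `Δ(φ)`: all roots lying in the span of the support of `φ`. -/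
def sub (φ : V) : Set V := {ψ ∈ R.Δ | ψ ∈ Submodule.span ℝ (R.support φ)}

/-- The positive roots `Δ(φ)₊` of the subsystem `Δ(φ)`. -/
def posSub (φ : V) : Set V := R.sub φ ∩ R.Pos

/-- `x` is a nonnegative integer combination of positive roots. -/
def NonnegComb (x : V) : Prop :=
  ∃ c : V →₀ ℕ, ↑c.support ⊆ R.Pos ∧ x = c.sum fun α n => (n : ℝ) • α

/-- `β` is the highest root of the subset `S`. -/
def IsHighest (S : Set V) (β : V) : Prop :=
  β ∈ S ∧ β ∈ R.Pos ∧ ∀ ψ ∈ S, R.NonnegComb (β - ψ)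

/-- `β` is locally high: it is the highest root of `Δ(β)`. -/
def LocallyHigh (β : V) : Prop := β ∈ R.Pos ∧ R.IsHighest (R.sub β) β

/-- `E(β) = {φ ∈ Δ(β) : (φ,β) > 0}`. -/
def E (β : V) : Set V := {φ ∈ R.sub β | 0 < ⟪φ, β⟫_ℝ}

/-- `Δ(β)° = {φ ∈ Δ(β) : (φ,β) = 0}`. -/
def orth (β : V) : Set V := {φ ∈ R.sub β | ⟪φ, β⟫_ℝ = 0}

/-- Strong orthogonality of two roots. -/
def StronglyOrth (φ ψ : V) : Prop := φ + ψ ∉ R.Δ ∧ φ - ψ ∉ R.Δ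


/-- Half the sum of the positive roots of `Δ(β)`. -/
noncomputable def rho (β : V) : V := (2⁻¹ : ℝ) • ∑ᶠ φ ∈ R.posSub β, φ

/-- The dual Coxeter number of `Δ(β)`, `⟨ρ_β, β^∨⟩ + 1`. -/
noncomputable def dualCoxeter (β : V) : ℝ := 2 * ⟪R.rho β, β⟫_ℝ / ⟪β, β⟫_ℝ + 1

end RootSystemData

/-- A finite set of vectors is irreducible if it is nonempty and admits no splitting into
two nonempty mutually orthogonal pieces. -/
def IsIrred {V : Type*} [NormedAddCommGroup V] [InnerProductSpace ℝ V] (S : Set V) : Prop :=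
  S.Nonempty ∧ ¬ ∃ A B : Set V, A ∪ B = S ∧ A ∩ B = ∅ ∧ A.Nonempty ∧ B.Nonempty ∧
    ∀ a ∈ A, ∀ b ∈ B, ⟪a, b⟫_ℝ = 0

/-- `C` is an irreducible component of `S`. -/
def IsComponent {V : Type*} [NormedAddCommGroup V] [InnerProductSpace ℝ V]
    (S C : Set V) : Prop :=
  C ⊆ S ∧ IsIrred C ∧ ∀ a ∈ C, ∀ b ∈ S \ C, ⟪a, b⟫_ℝ = 0

/-- The reflection `s_β` in the (co)vector `β`. -/
noncomputable def reflectRoot {V : Type*} [NormedAddCommGroup V] [InnerProductSpace ℝ V]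
    (β v : V) : V := v - (2 * ⟪v, β⟫_ℝ / ⟪β, β⟫_ℝ) • β

namespace RootSystemData

variable {V : Type*} [NormedAddCommGroup V] [InnerProductSpace ℝ V] (R : RootSystemData V)

/-- A chain cascade: a nonempty list whose head is the highest root of an irreducible
component of `Δ`, and each subsequent entry is the highest root of an irreducible component
of `Δ(previous)°`. -/
def IsChainCascade (l : List V) : Prop :=
  l ≠ [] ∧
  (∀ b ∈ l.head?, ∃ C, IsComponent R.Δ C ∧ R.IsHighest C b) ∧
  l.Chain' fun γ δ => ∃ C, IsComponent (R.orth γ) C ∧ R.IsHighest C δ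

/-- The cascade `ℬ` of roots: all positive roots belonging to some chain cascade. -/
def cascade : Set V := {β | ∃ l, R.IsChainCascade l ∧ β ∈ l}

/-- `l` is the chain cascade `C(φ)` associated to the positive root `φ`. -/
def IsCascadeChainOf (φ : V) (l : List V) : Prop :=
  R.IsChainCascade l ∧ (∀ β ∈ l, φ ∈ R.sub β) ∧
  (∀ β ∈ l.dropLast, ⟪φ, β⟫_ℝ = 0) ∧ ∀ β ∈ l.getLast?, 0 < ⟪φ, β⟫_ℝ

end RootSystemData

namespace RootSystemData

variable {V : Type*} [NormedAddCommGroup V] [InnerProductSpace ℝ V] (R : RootSystemData V)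

/-- The monoid generated by the positive roots. -/
def posCone : AddSubmonoid V := AddSubmonoid.closure R.Pos

variable {R}

lemma ne_zero_of_mem {α : V} (hα : α ∈ R.Δ) : α ≠ 0 := fun h => R.zero_not_mem (h ▸ hα)

lemma inner_self_pos_of_mem {α : V} (hα : α ∈ R.Δ) : 0 < ⟪α, α⟫_ℝ :=
  real_inner_self_pos.2 (ne_zero_of_mem hα)

lemma mem_posCone {α : V} (hα : α ∈ R.Pos) : α ∈ R.posCone := AddSubmonoid.subset_closure hα

lemma reflect_mem_of_eq {α β : V} (hα : α ∈ R.Δ) (hβ : β ∈ R.Δ) {n : ℝ}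
    (h : 2 * ⟪α, β⟫_ℝ = n * ⟪β, β⟫_ℝ) : α - n • β ∈ R.Δ := by
  have := R.reflect_mem α hα β hβ
  rwa [h, mul_div_cancel_right₀ _ (inner_self_pos_of_mem hβ).ne'] at this

/-- The difference of two distinct roots at an acute angle is a root. -/
lemma sub_mem_of_inner_pos {α β : V} (hα : α ∈ R.Δ) (hβ : β ∈ R.Δ) (hne : α ≠ β)
    (h : 0 < ⟪α, β⟫_ℝ) : α - β ∈ R.Δ := by
  obtain ⟨n, hn⟩ := R.crystal α hα β hβ
  obtain ⟨m, hm⟩ := R.crystal β hβ α hα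
  have hαα := inner_self_pos_of_mem hα
  have hββ := inner_self_pos_of_mem hβ
  have hcomm := real_inner_comm α β
  have hn0 : 0 < n := by
    have : (0 : ℝ) < n := by by_contra hc; nlinarith
    exact_mod_cast this
  have hm0 : 0 < m := by
    have : (0 : ℝ) < m := by by_contra hc; nlinarith
    exact_mod_cast this
  by_cases hn1 : n = 1
  · simpa [hn1] using reflect_mem_of_eq hα hβ hn
  by_cases hm1 : m = 1
  · simpa [hm1] using R.neg_mem _ (reflect_mem_of_eq hβ hα hm)
  exfalso
  have hn2 : (2 : ℝ) ≤ n := by exact_mod_cast (by omega : 2 ≤ n)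
  have hm2 : (2 : ℝ) ≤ m := by exact_mod_cast (by omega : 2 ≤ m)
  have hpos : 0 < ⟪α - β, α - β⟫_ℝ := real_inner_self_pos.2 (sub_ne_zero.2 hne)
  rw [real_inner_sub_sub_self] at hpos
  nlinarith

/-- The sum of two roots at an obtuse angle is a root, unless it vanishes. -/
lemma add_mem_of_inner_neg {α β : V} (hα : α ∈ R.Δ) (hβ : β ∈ R.Δ) (hne : α + β ≠ 0)
    (h : ⟪α, β⟫_ℝ < 0) : α + β ∈ R.Δ := by
  have := sub_mem_of_inner_pos hα (R.neg_mem β hβ) (fun h' => hne (by simp [h']))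
    (by rw [inner_neg_right]; linarith)
  simpa using this

lemma pos_add_ne_zero {α β : V} (hα : α ∈ R.Pos) (hβ : β ∈ R.Pos) : α + β ≠ 0 := fun h =>
  R.not_neg_mem α hα (by rwa [neg_eq_of_add_eq_zero_right h])

lemma pos_add_mem_of_inner_neg {α β : V} (hα : α ∈ R.Pos) (hβ : β ∈ R.Pos)
    (h : ⟪α, β⟫_ℝ < 0) : α + β ∈ R.Pos :=
  R.pos_add _ hα _ hβ <|
    add_mem_of_inner_neg (R.pos_subset hα) (R.pos_subset hβ) (pos_add_ne_zero hα hβ) h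

lemma inner_multiset_sum (a : V) (s : Multiset V) :
    ⟪a, s.sum⟫_ℝ = (s.map fun x => ⟪a, x⟫_ℝ).sum := by
  induction s using Multiset.induction_on with
  | empty => simp
  | cons x s ih => simp [inner_add_right, ih]

/-- A nonempty sum of positive roots does not vanish. -/
lemma multiset_sum_ne_zero (n : ℕ) : ∀ s : Multiset V, s.card = n → (∀ x ∈ s, x ∈ R.Pos) →
    s ≠ 0 → s.sum ≠ 0 := by
  induction n with
  | zero => intro s hs _ h0; exact absurd (Multiset.card_eq_zero.1 hs) h0
  | succ n ih =>
    intro s hs hpos _ hsum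
    obtain ⟨a, has⟩ := Multiset.card_pos_iff_exists_mem.1 (show 0 < s.card by omega)
    obtain ⟨t, rfl⟩ := Multiset.exists_cons_of_mem has
    have ha : a ∈ R.Pos := hpos a (by simp)
    have h0 : ⟪a, a⟫_ℝ + (t.map fun x => ⟪a, x⟫_ℝ).sum = 0 := by
      rw [← inner_multiset_sum, ← inner_add_right, ← Multiset.sum_cons, hsum, inner_zero_right]
    have haa := inner_self_pos_of_mem (R.pos_subset ha)
    obtain ⟨x, hx, hneg⟩ : ∃ x ∈ t, ⟪a, x⟫_ℝ < 0 := by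
      by_contra! hc
      have : 0 ≤ (t.map fun x => ⟪a, x⟫_ℝ).sum := Multiset.sum_nonneg (by simpa using hc)
      linarith
    obtain ⟨u, rfl⟩ := Multiset.exists_cons_of_mem hx
    refine ih ((a + x) ::ₘ u) (by simpa using hs) ?_ (by simp) ?_
    · intro y hy
      rcases Multiset.mem_cons.1 hy with rfl | hy
      · exact pos_add_mem_of_inner_neg ha (hpos x (by simp)) hneg
      · exact hpos y (by simp [hy])
    · simpa [add_assoc] using hsum

/-- The positive cone is pointed. -/
lemma eq_zero_of_mem_posCone {x : V} (hx : x ∈ R.posCone) (hx' : -x ∈ R.posCone) : x = 0 := by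
  obtain ⟨s, hs, hsx⟩ := AddSubmonoid.exists_multiset_of_mem_closure hx
  obtain ⟨t, ht, htx⟩ := AddSubmonoid.exists_multiset_of_mem_closure hx'
  have hst : s + t = 0 := by
    by_contra h
    refine multiset_sum_ne_zero (R := R) _ (s + t) rfl ?_ h (by simp [hsx, htx])
    intro y hy
    exact (Multiset.mem_add.1 hy).elim (hs y) (ht y)
  rw [← hsx, (add_eq_zero.1 hst).1, Multiset.sum_zero]

lemma neg_notMem_posCone {α : V} (hα : α ∈ R.Pos) : -α ∉ R.posCone := fun h =>
  ne_zero_of_mem (R.pos_subset hα) (eq_zero_of_mem_posCone (mem_posCone hα) h)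

lemma NonnegComb.mem_posCone {x : V} (hx : R.NonnegComb x) : x ∈ R.posCone := by
  obtain ⟨c, hc, rfl⟩ := hx
  refine sum_mem fun α hα => ?_
  change (c α : ℝ) • α ∈ R.posCone
  rw [Nat.cast_smul_eq_nsmul]
  exact nsmul_mem (RootSystemData.mem_posCone (hc hα)) _

lemma IsHighest.unique {S : Set V} {β β' : V} (h : R.IsHighest S β) (h' : R.IsHighest S β') :
    β = β' :=
  sub_eq_zero.1 <| eq_zero_of_mem_posCone (h.2.2 β' h'.1).mem_posCone
    (by simpa using (h'.2.2 β h.1).mem_posCone)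

/-- Every positive root is a sum of simple roots. -/
lemma mem_closure_simple : ∀ (n : ℕ) (α : V), α ∈ R.Pos →
    {β ∈ R.Pos | α - β ∈ R.posCone}.ncard = n → α ∈ AddSubmonoid.closure R.Simple := by
  intro n
  induction n using Nat.strong_induction_on with
  | _ n ih =>
    intro α hα hn
    by_cases hs : α ∈ R.Simple
    · exact AddSubmonoid.subset_closure hs
    have key : ∀ β ∈ R.Pos, ∀ γ ∈ R.Pos, α = β + γ → β ∈ AddSubmonoid.closure R.Simple := by
      rintro β hβ γ hγ rfl
      refine ih _ ?_ β hβ rfl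
      rw [← hn]
      refine Set.ncard_lt_ncard ?_ ((R.finite.subset R.pos_subset).subset fun x hx => hx.1)
      refine (Set.ssubset_iff_of_subset ?_).2 ⟨β + γ, ⟨hα, by simp [zero_mem]⟩, ?_⟩
      · rintro δ ⟨hδ, h⟩
        refine ⟨hδ, ?_⟩
        rw [add_sub_right_comm]
        exact add_mem h (mem_posCone hγ)
      · rintro ⟨-, h⟩
        exact neg_notMem_posCone hγ (by simpa using h)
    have hex : ∃ β ∈ R.Pos, ∃ γ ∈ R.Pos, α = β + γ := by
      by_contra h
      exact hs ⟨hα, h⟩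
    obtain ⟨β, hβ, γ, hγ, h⟩ := hex
    rw [h]
    exact add_mem (key β hβ γ hγ h) (key γ hγ β hβ (h.trans (add_comm _ _)))

noncomputable instance : Fintype R.Simple :=
  (R.finite.subset fun _ h => R.pos_subset h.1).fintype

/-- A positive root is a nonnegative combination of simple roots. -/
lemma exists_coeff {φ : V} (hφ : φ ∈ R.Pos) :
    ∃ c : R.Simple → ℝ, (∀ i, 0 ≤ c i) ∧ φ = ∑ i, c i • (i : V) := by
  classical
  refine AddSubmonoid.closure_induction
    (motive := fun φ _ => ∃ c : R.Simple → ℝ, (∀ i, 0 ≤ c i) ∧ φ = ∑ i, c i • (i : V))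
    ?_ ?_ ?_ (mem_closure_simple _ φ hφ rfl)
  · intro α hα
    refine ⟨Pi.single ⟨α, hα⟩ 1, fun i => ?_, ?_⟩
    · by_cases h : i = ⟨α, hα⟩ <;> simp [h]
    · simp [Pi.single_apply, ite_smul]
  · exact ⟨0, by simp, by simp⟩
  · rintro x y - - ⟨c, hc, rfl⟩ ⟨d, hd, rfl⟩
    exact ⟨c + d, fun i => add_nonneg (hc i) (hd i), by simp [add_smul, Finset.sum_add_distrib]⟩

lemma simple_inner_nonpos {α β : V} (hα : α ∈ R.Simple) (hβ : β ∈ R.Simple) (hne : α ≠ β) :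
    ⟪α, β⟫_ℝ ≤ 0 := by
  by_contra! h
  rcases R.mem_or_neg _ (sub_mem_of_inner_pos (R.pos_subset hα.1) (R.pos_subset hβ.1) hne h)
    with h | h
  · exact hα.2 ⟨β, hβ.1, _, h, by abel⟩
  · exact hβ.2 ⟨α, hα.1, _, h, by abel⟩

/-- A vanishing sum of simple roots with natural coefficients is trivial. -/
lemma natCoeff_eq_zero {c : R.Simple → ℕ} (h : ∑ i, c i • (i : V) = 0) (i : R.Simple) :
    c i = 0 := by
  classical
  have hmem : ∀ j : R.Simple, c j • (j : V) ∈ R.posCone := fun j =>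
    nsmul_mem (mem_posCone j.2.1) _
  rw [← Finset.add_sum_erase _ _ (Finset.mem_univ i)] at h
  have h0 : c i • (i : V) = 0 := by
    refine eq_zero_of_mem_posCone (hmem i) ?_
    rw [neg_eq_of_add_eq_zero_right h]
    exact sum_mem fun j _ => hmem j
  rw [← Nat.cast_smul_eq_nsmul ℝ] at h0
  exact Nat.cast_eq_zero.1 <| (smul_eq_zero.1 h0).resolve_right (ne_zero_of_mem (R.pos_subset i.2.1))

/-- A vanishing sum of simple roots with integer coefficients is trivial. -/
lemma intCoeff_eq_zero {v : R.Simple → ℤ} (h : ∑ i, v i • (i : V) = 0) : v = 0 := by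
  set p : V := ∑ i, (v i).toNat • (i : V) with hp
  set q : V := ∑ i, (-v i).toNat • (i : V) with hq
  have hpq : p = q := by
    rw [← sub_eq_zero, hp, hq, ← Finset.sum_sub_distrib, ← h]
    refine Finset.sum_congr rfl fun i _ => ?_
    rw [← natCast_zsmul, ← natCast_zsmul, ← sub_smul, Int.toNat_sub_toNat_neg]
  have hle : ⟪p, q⟫_ℝ ≤ 0 := by
    rw [hp, hq, sum_inner]
    refine Finset.sum_nonpos fun i _ => ?_
    rw [inner_sum]
    refine Finset.sum_nonpos fun j _ => ?_
    rw [← Nat.cast_smul_eq_nsmul ℝ, ← Nat.cast_smul_eq_nsmul ℝ, real_inner_smul_left,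
      real_inner_smul_right]
    by_cases hij : i = j
    · subst hij
      rcases le_total 0 (v i) with h | h
      · simp [Int.toNat_of_nonpos (neg_nonpos.2 h)]
      · simp [Int.toNat_of_nonpos h]
    · exact mul_nonpos_of_nonneg_of_nonpos (Nat.cast_nonneg _) <|
        mul_nonpos_of_nonneg_of_nonpos (Nat.cast_nonneg _) <|
          simple_inner_nonpos i.2 j.2 fun h => hij (Subtype.ext h)
  have hp0 : p = 0 := by
    rw [← hpq] at hle
    exact real_inner_self_nonpos.1 hle
  funext i
  have h1 := natCoeff_eq_zero hp0 i
  have h2 := natCoeff_eq_zero (hpq ▸ hp0 : q = 0) i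
  simp only [Pi.zero_apply]
  omega

/-- The simple roots are linearly independent. -/
lemma linearIndependent_simple : LinearIndependent ℝ (fun i : R.Simple => (i : V)) := by
  classical
  rw [Fintype.linearIndependent_iff]
  by_contra! hg
  obtain ⟨g, hg, k, hk⟩ := hg
  choose n hn using fun i j : R.Simple =>
    R.crystal i (R.pos_subset i.2.1) j (R.pos_subset j.2.1)
  have hjj : ∀ j : R.Simple, ⟪(j : V), j⟫_ℝ ≠ 0 := fun j =>
    (inner_self_pos_of_mem (R.pos_subset j.2.1)).ne'
  have key : ∀ (c : R.Simple → ℝ) (j : R.Simple),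
      (∑ i, c i * (n i j : ℝ)) * ⟪(j : V), j⟫_ℝ = 2 * ⟪∑ i, c i • (i : V), (j : V)⟫_ℝ := by
    intro c j
    rw [sum_inner, Finset.sum_mul, Finset.mul_sum]
    refine Finset.sum_congr rfl fun i _ => ?_
    rw [real_inner_smul_left, mul_assoc, ← hn i j]
    ring
  let A : Matrix R.Simple R.Simple ℤ := Matrix.of n
  have hdet : (A.map (Int.castRingHom ℝ)).det = 0 := by
    refine Matrix.exists_vecMul_eq_zero_iff.1 ⟨g, fun h => hk (by simp [h]), ?_⟩
    funext j
    have := key g j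
    rw [hg, inner_zero_left, mul_zero] at this
    simpa [Matrix.vecMul, dotProduct, A] using (mul_eq_zero.1 this).resolve_right (hjj j)
  have hdetZ : A.det = 0 := by
    have h := (Int.castRingHom ℝ).map_det A
    rw [RingHom.mapMatrix_apply, hdet] at h
    simpa using h
  obtain ⟨v, hv0, hv⟩ := Matrix.exists_vecMul_eq_zero_iff.2 hdetZ
  refine hv0 (intCoeff_eq_zero ?_)
  set w : V := ∑ i, v i • (i : V) with hw
  have hw' : w = ∑ i, (v i : ℝ) • (i : V) := by simp [hw, Int.cast_smul_eq_zsmul]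
  have horth : ∀ j : R.Simple, ⟪w, (j : V)⟫_ℝ = 0 := by
    intro j
    have h := key (fun i => (v i : ℝ)) j
    have hvj : ∑ i, v i * n i j = 0 := by
      simpa [Matrix.vecMul, dotProduct, A] using congrFun hv j
    have hvj' : ∑ i, (v i : ℝ) * (n i j : ℝ) = 0 := by exact_mod_cast hvj
    rw [hvj', ← hw'] at h
    linarith
  have : ⟪w, w⟫_ℝ = 0 := by
    nth_rewrite 1 [hw']
    rw [sum_inner]
    refine Finset.sum_eq_zero fun i _ => ?_
    rw [real_inner_smul_left, real_inner_comm, horth, mul_zero]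
  exact inner_self_eq_zero.1 this

/-- The support of a combination of simple roots consists of those with nonzero coefficient. -/
lemma mem_support_iff {c : R.Simple → ℝ} (i : R.Simple) :
    (i : V) ∈ R.support (∑ j, c j • (j : V)) ↔ c i ≠ 0 := by
  classical
  have hrest : ∑ j ∈ Finset.univ.erase i, c j • (j : V) ∈
      Submodule.span ℝ (R.Simple \ {(i : V)}) := by
    refine sum_mem fun j hj => Submodule.smul_mem _ _ (Submodule.subset_span ⟨j.2, ?_⟩)
    exact fun h => (Finset.mem_erase.1 hj).1 (Subtype.ext h)
  rw [support, Set.mem_sep_iff, ← Finset.add_sum_erase _ _ (Finset.mem_univ i),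
    Submodule.add_mem_iff_left _ hrest]
  constructor
  · rintro ⟨-, h⟩ h0
    simp [h0] at h
  · refine fun hc => ⟨i.2, fun h => ?_⟩
    have hi : (i : V) ∈ Submodule.span ℝ (R.Simple \ {(i : V)}) :=
      (Submodule.smul_mem_iff _ hc).1 h
    have himage : (fun j : R.Simple => (j : V)) '' (Set.univ \ {i}) = R.Simple \ {(i : V)} := by
      ext x
      simp only [Set.mem_image, Set.mem_sdiff, Set.mem_univ, true_and, Set.mem_singleton_iff]
      constructor
      · rintro ⟨j, hj, rfl⟩
        exact ⟨j.2, fun h => hj (Subtype.ext h)⟩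
      · rintro ⟨hx, hxi⟩
        exact ⟨⟨x, hx⟩, fun h => hxi (congrArg Subtype.val h), rfl⟩
    refine linearIndependent_iff_notMem_span.1 (linearIndependent_simple (R := R)) i ?_
    rwa [himage]

lemma support_subset_simple (φ : V) : R.support φ ⊆ R.Simple := fun _ h => h.1

lemma mem_span_support {φ : V} (hφ : φ ∈ R.Pos) : φ ∈ Submodule.span ℝ (R.support φ) := by
  obtain ⟨c, -, rfl⟩ := exists_coeff hφ
  have h : ∀ i : R.Simple, c i • (i : V) ∈
      Submodule.span ℝ (R.support (∑ j, c j • (j : V))) := by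
    intro i
    by_cases hc : c i = 0
    · simp [hc]
    · exact Submodule.smul_mem _ _ (Submodule.subset_span ((mem_support_iff i).2 hc))
  exact sum_mem fun i _ => h i

lemma support_subset_of_mem_span {φ : V} {T : Set V} (hT : T ⊆ R.Simple)
    (hφ : φ ∈ Submodule.span ℝ T) : R.support φ ⊆ T := by
  rintro α ⟨hα, hnot⟩
  by_contra h
  have hsub : T ⊆ R.Simple \ {α} := fun x hx => ⟨hT hx, fun hxα => h (hxα ▸ hx)⟩
  exact hnot (Submodule.span_mono hsub hφ)

lemma mem_sub_self {φ : V} (hφ : φ ∈ R.Pos) : φ ∈ R.sub φ :=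
  ⟨R.pos_subset hφ, mem_span_support hφ⟩

lemma sub_subset_sub {φ ψ : V} (h : φ ∈ R.sub ψ) : R.sub φ ⊆ R.sub ψ := by
  have hsupp := support_subset_of_mem_span (support_subset_simple ψ) h.2
  exact fun x hx => ⟨hx.1, Submodule.span_mono hsupp hx.2⟩

lemma support_subset_support_add {φ ψ : V} (hφ : φ ∈ R.Pos) (hψ : ψ ∈ R.Pos) :
    R.support φ ⊆ R.support (φ + ψ) := by
  obtain ⟨c, hc, rfl⟩ := exists_coeff hφ
  obtain ⟨d, hd, rfl⟩ := exists_coeff hψ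
  intro α hα
  have h := (mem_support_iff ⟨α, hα.1⟩).1 hα
  have hadd : ∑ j, c j • (j : V) + ∑ j, d j • (j : V) = ∑ j, (c j + d j) • (j : V) := by
    simp [add_smul, Finset.sum_add_distrib]
  rw [hadd]
  refine (mem_support_iff ⟨α, hα.1⟩).2 (ne_of_gt ?_)
  have := lt_of_le_of_ne (hc _) h.symm
  linarith [hd ⟨α, hα.1⟩]

lemma inner_eq_zero_of_mem_span {A B : Set V} (h : ∀ a ∈ A, ∀ b ∈ B, ⟪a, b⟫_ℝ = 0) {x y : V}
    (hx : x ∈ Submodule.span ℝ A) (hy : y ∈ Submodule.span ℝ B) : ⟪x, y⟫_ℝ = 0 :=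
  (Submodule.isOrtho_span.2 fun _ ha _ hb => h _ ha _ hb).inner_eq hx hy

lemma sub_notMem_pos {T T' : Set V}
    (hT : T ⊆ R.Simple)
    (horth : ∀ a ∈ T, ∀ b ∈ T', ⟪a, b⟫_ℝ = 0)
    {φ ψ : V} (hφ : φ ∈ Submodule.span ℝ T)
    (hψ : ψ ∈ Submodule.span ℝ T') (hψp : ψ ∈ R.Pos) : φ - ψ ∉ R.Pos := by
  intro h
  have hsub := support_subset_support_add hψp h
  rw [add_sub_cancel] at hsub
  have hmem : ψ ∈ Submodule.span ℝ T :=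
    Submodule.span_mono (hsub.trans (support_subset_of_mem_span hT hφ)) (mem_span_support hψp)
  exact (inner_self_pos_of_mem (R.pos_subset hψp)).ne' (inner_eq_zero_of_mem_span horth hmem hψ)

lemma stronglyOrth_of_pos {T T' : Set V}
    (hT : T ⊆ R.Simple) (hT' : T' ⊆ R.Simple)
    (horth : ∀ a ∈ T, ∀ b ∈ T', ⟪a, b⟫_ℝ = 0)
    {φ ψ : V} (hφ : φ ∈ Submodule.span ℝ T)
    (hψ : ψ ∈ Submodule.span ℝ T') (hφp : φ ∈ R.Pos) (hψp : ψ ∈ R.Pos) :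
    R.StronglyOrth φ ψ := by
  have hdiff : φ - ψ ∉ R.Δ := by
    intro h
    rcases R.mem_or_neg _ h with h | h
    · exact sub_notMem_pos hT horth hφ hψ hψp h
    · rw [neg_sub] at h
      exact sub_notMem_pos hT' (fun a ha b hb => by rw [real_inner_comm]; exact horth b hb a ha)
        hψ hφ hφp h
  refine ⟨fun h => hdiff ?_, hdiff⟩
  have h2 : φ + ψ - (2 : ℝ) • ψ ∈ R.Δ := by
    refine reflect_mem_of_eq h (R.pos_subset hψp) ?_
    rw [inner_add_left, inner_eq_zero_of_mem_span horth hφ hψ, zero_add]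
  rwa [two_smul, add_sub_add_right_eq_sub] at h2

/-- Roots in the spans of orthogonal sets of simple roots are strongly orthogonal. -/
lemma stronglyOrth_of_mem_span {T T' : Set V}
    (hT : T ⊆ R.Simple) (hT' : T' ⊆ R.Simple)
    (horth : ∀ a ∈ T, ∀ b ∈ T', ⟪a, b⟫_ℝ = 0)
    {φ ψ : V} (hφ : φ ∈ Submodule.span ℝ T)
    (hψ : ψ ∈ Submodule.span ℝ T') (hφΔ : φ ∈ R.Δ) (hψΔ : ψ ∈ R.Δ) :
    R.StronglyOrth φ ψ := by
  have hneg : ∀ {x : V}, x ∈ R.Δ ↔ -x ∈ R.Δ := fun {x} =>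
    ⟨R.neg_mem x, fun h => by simpa using R.neg_mem _ h⟩
  rcases R.mem_or_neg φ hφΔ with h1 | h1 <;> rcases R.mem_or_neg ψ hψΔ with h2 | h2
  · exact stronglyOrth_of_pos hT hT' horth hφ hψ h1 h2
  · have := stronglyOrth_of_pos hT hT' horth hφ (Submodule.neg_mem _ hψ) h1 h2
    exact ⟨by simpa using this.2, by simpa [sub_eq_add_neg] using this.1⟩
  · have := stronglyOrth_of_pos hT hT' horth (Submodule.neg_mem _ hφ) hψ h1 h2
    refine ⟨fun h => this.2 ?_, fun h => this.1 ?_⟩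
    · convert R.neg_mem _ h using 1; abel
    · convert R.neg_mem _ h using 1; abel
  · have := stronglyOrth_of_pos hT hT' horth (Submodule.neg_mem _ hφ) (Submodule.neg_mem _ hψ) h1 h2
    refine ⟨fun h => this.1 ?_, fun h => this.2 ?_⟩
    · convert R.neg_mem _ h using 1; abel
    · convert R.neg_mem _ h using 1; abel

/-- Distinct irreducible components are orthogonal. -/
lemma inner_eq_zero_of_isComponent {S C C' : Set V} (hC : IsComponent S C)
    (hC' : IsComponent S C') (hne : C ≠ C') : ∀ a ∈ C, ∀ b ∈ C', ⟪a, b⟫_ℝ = 0 := by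
  have key : ∀ {C C' : Set V}, IsComponent S C → IsComponent S C' →
      (C ∩ C').Nonempty → C ⊆ C' := by
    intro C C' hC hC' hn x hx
    by_contra hxn
    refine hC.2.1.2 ⟨C ∩ C', C \ C', Set.inter_union_sdiff C C', ?_, hn, ⟨x, hx, hxn⟩, ?_⟩
    · exact Set.disjoint_iff_inter_eq_empty.1 (Set.disjoint_sdiff_inter (s := C) (t := C')).symm
    · exact fun a ha b hb => hC'.2.2 a ha.2 b ⟨hC.1 hb.1, hb.2⟩
  intro a ha b hb
  refine hC.2.2 a ha b ⟨hC'.1 hb, fun hbC => hne ?_⟩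
  exact (key hC hC' ⟨b, hbC, hb⟩).antisymm (key hC' hC ⟨b, hb, hbC⟩)

/-- A set of roots closed under sums and containing the supports of its positive elements. -/
structure SupportClosed (R : RootSystemData V) (S : Set V) : Prop where
  subset : S ⊆ R.Δ
  add_mem : ∀ a ∈ S, ∀ b ∈ S, a + b ∈ R.Δ → a + b ∈ S
  support_subset : ∀ a ∈ S, a ∈ R.Pos → R.support a ⊆ S

/-- `b` is the highest root of an irreducible component of `S`. -/
def IsCompHighest (R : RootSystemData V) (S : Set V) (b : V) : Prop :=
  ∃ C, IsComponent S C ∧ R.IsHighest C b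

lemma supportClosed_roots : R.SupportClosed R.Δ :=
  ⟨subset_rfl, fun _ _ _ _ h => h, fun _ _ _ _ h => R.pos_subset h.1.1⟩

/-- The highest root of a component is dominant on its support. -/
lemma IsCompHighest.inner_nonneg {S : Set V} (hS : R.SupportClosed S) {b : V}
    (hb : R.IsCompHighest S b) {α : V} (hα : α ∈ R.support b) : 0 ≤ ⟪α, b⟫_ℝ := by
  obtain ⟨C, hC, hbC⟩ := hb
  by_contra! hneg
  have hαS : α ∈ S := hS.support_subset b (hC.1 hbC.1) hbC.2.1 hα
  have hαC : α ∈ C := by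
    by_contra h
    have := hC.2.2 b hbC.1 α ⟨hαS, h⟩
    rw [real_inner_comm] at this
    exact hneg.ne this
  have hsum : α + b ∈ R.Δ := R.pos_subset (pos_add_mem_of_inner_neg hα.1.1 hbC.2.1 hneg)
  have hsumS : α + b ∈ S := hS.add_mem _ hαS _ (hC.1 hbC.1) hsum
  have hsumC : α + b ∈ C := by
    by_contra h
    have h1 := hC.2.2 α hαC _ ⟨hsumS, h⟩
    have h2 := hC.2.2 b hbC.1 _ ⟨hsumS, h⟩
    apply (inner_self_pos_of_mem hsum).ne'
    conv_lhs => rw [inner_add_left, h1, h2, add_zero]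
  have := (hbC.2.2 _ hsumC).mem_posCone
  exact neg_notMem_posCone hα.1.1 (by simpa using this)

lemma IsCompHighest.supportClosed_orth {S : Set V} (hS : R.SupportClosed S) {b : V}
    (hb : R.IsCompHighest S b) : R.SupportClosed (R.orth b) := by
  refine ⟨fun x hx => hx.1.1, fun x hx y hy h => ⟨⟨h, add_mem hx.1.2 hy.1.2⟩, ?_⟩, ?_⟩
  · rw [inner_add_left, hx.2, hy.2, add_zero]
  · intro φ hφ hφp α hα
    have hsub : R.support φ ⊆ R.support b :=
      support_subset_of_mem_span (support_subset_simple b) hφ.1.2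
    refine ⟨⟨R.pos_subset hα.1.1, Submodule.subset_span (hsub hα)⟩, ?_⟩
    have h0 := hφ.2
    obtain ⟨c, hc, rfl⟩ := exists_coeff hφp
    rw [sum_inner] at h0
    have hterm : ∀ i : R.Simple, 0 ≤ ⟪c i • (i : V), b⟫_ℝ := by
      intro i
      rw [real_inner_smul_left]
      by_cases hci : c i = 0
      · simp [hci]
      · exact mul_nonneg (hc i) (hb.inner_nonneg hS (hsub ((mem_support_iff i).2 hci)))
    have h1 := (Finset.sum_eq_zero_iff_of_nonneg fun i _ => hterm i).1 h0 ⟨α, hα.1⟩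
      (Finset.mem_univ _)
    rw [real_inner_smul_left] at h1
    exact (mul_eq_zero.1 h1).resolve_left ((mem_support_iff ⟨α, hα.1⟩).1 hα)

/-- The support of a positive root of a component lies in the component. -/
lemma support_subset_component {S C : Set V} (hS : R.SupportClosed S) (hC : IsComponent S C)
    {b : V} (hb : b ∈ C) (hbp : b ∈ R.Pos) : R.support b ⊆ C := by
  classical
  have hSb := hS.support_subset b (hC.1 hb) hbp
  obtain ⟨c, hc, rfl⟩ := exists_coeff hbp
  set b : V := ∑ i, c i • (i : V) with hbdef
  set d : R.Simple → ℝ := fun i => if (i : V) ∈ C then 0 else c i with hd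
  set e : R.Simple → ℝ := fun i => if (i : V) ∈ C then c i else 0 with he
  have hdmem : ∑ i, d i • (i : V) ∈ Submodule.span ℝ (S \ C) := by
    refine sum_mem fun i _ => ?_
    by_cases hi : (i : V) ∈ C
    · simp [hd, hi]
    by_cases hci : c i = 0
    · simp [hd, hci]
    · exact Submodule.smul_mem _ _ (Submodule.subset_span ⟨hSb ((mem_support_iff i).2 hci), hi⟩)
  have hemem : ∑ i, e i • (i : V) ∈ Submodule.span ℝ C := by
    refine sum_mem fun i _ => ?_
    by_cases hi : (i : V) ∈ C
    · exact Submodule.smul_mem _ _ (Submodule.subset_span hi)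
    · simp [he, hi]
  have hsum : ∑ i, d i • (i : V) = b - ∑ i, e i • (i : V) := by
    rw [hbdef, ← Finset.sum_sub_distrib]
    refine Finset.sum_congr rfl fun i _ => ?_
    by_cases hi : (i : V) ∈ C <;> simp [hd, he, hi]
  have hd0 : ∑ i, d i • (i : V) = 0 := by
    have hdC : ∑ i, d i • (i : V) ∈ Submodule.span ℝ C := by
      rw [hsum]
      exact sub_mem (Submodule.subset_span hb) hemem
    exact inner_self_eq_zero.1 (inner_eq_zero_of_mem_span hC.2.2 hdC hdmem)
  intro α hα
  by_contra hαC
  have h0 := Fintype.linearIndependent_iff.1 (linearIndependent_simple (R := R)) d hd0 ⟨α, hα.1⟩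
  exact (mem_support_iff ⟨α, hα.1⟩).1 hα (by simpa [hd, hαC] using h0)

lemma IsCompHighest.mem {S : Set V} {b : V} (hb : R.IsCompHighest S b) : b ∈ S := by
  obtain ⟨C, hC, h⟩ := hb
  exact hC.1 h.1

lemma IsCompHighest.pos {S : Set V} {b : V} (hb : R.IsCompHighest S b) : b ∈ R.Pos := by
  obtain ⟨C, hC, h⟩ := hb
  exact h.2.1

lemma IsCompHighest.support_orthogonal {S : Set V} (hS : R.SupportClosed S) {b b' : V}
    (hb : R.IsCompHighest S b) (hb' : R.IsCompHighest S b') (hne : b ≠ b') :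
    ∀ x ∈ R.support b, ∀ y ∈ R.support b', ⟪x, y⟫_ℝ = 0 := by
  obtain ⟨C, hC, h⟩ := hb
  obtain ⟨C', hC', h'⟩ := hb'
  have hCC : C ≠ C' := by
    rintro rfl
    exact hne (h.unique h')
  exact fun x hx y hy => inner_eq_zero_of_isComponent hC hC' hCC x
    (support_subset_component hS hC h.1 h.2.1 hx) y
    (support_subset_component hS hC' h'.1 h'.2.1 hy)

/-- If `c ∈ Δ(b)°` is a positive root then `Δ(c) ⊆ Δ(b)°`. -/
lemma sub_subset_orth {b c : V} (hS : R.SupportClosed (R.orth b)) (hc : c ∈ R.orth b)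
    (hcp : c ∈ R.Pos) : R.sub c ⊆ R.orth b := by
  refine fun x hx => ⟨sub_subset_sub hc.1 hx, ?_⟩
  exact inner_eq_zero_of_mem_span (B := {b})
    (fun a ha y hy => by rw [hy]; exact (hS.support_subset c hc hcp ha).2) hx.2
    (Submodule.mem_span_singleton_self b)

/-- A possibly empty chain cascade starting inside `S`. -/
def ChainFrom (R : RootSystemData V) : Set V → List V → Prop
  | _, [] => True
  | S, b :: t => R.IsCompHighest S b ∧ ChainFrom R (R.orth b) t

lemma chainFrom_cons_iff {b : V} {t : List V} : R.ChainFrom (R.orth b) t ↔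
    (b :: t).IsChain fun γ δ => ∃ C, IsComponent (R.orth γ) C ∧ R.IsHighest C δ := by
  induction t generalizing b with
  | nil => simp [ChainFrom]
  | cons c t ih => rw [List.isChain_cons_cons, ← ih]; rfl

lemma isChainCascade_iff {l : List V} :
    R.IsChainCascade l ↔ l ≠ [] ∧ R.ChainFrom R.Δ l := by
  cases l with
  | nil => simp [IsChainCascade]
  | cons b t =>
    have : R.ChainFrom R.Δ (b :: t) ↔ R.IsCompHighest R.Δ b ∧ R.ChainFrom (R.orth b) t := Iff.rfl
    rw [this, chainFrom_cons_iff]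
    simp only [IsChainCascade, IsCompHighest, List.head?_cons, Option.mem_some_iff, forall_eq']
    exact Iff.rfl

lemma ChainFrom.of_append {S : Set V} {l t : List V} (h : R.ChainFrom S (l ++ t)) :
    R.ChainFrom S l := by
  induction l generalizing S with
  | nil => trivial
  | cons b l ih => exact ⟨h.1, ih h.2⟩

lemma ChainFrom.mem_pos {S : Set V} {l : List V} (h : R.ChainFrom S l) {x : V} (hx : x ∈ l) :
    x ∈ R.Pos := by
  induction l generalizing S with
  | nil => simp at hx
  | cons b l ih =>
    rcases List.mem_cons.1 hx with rfl | hx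
    · exact h.1.pos
    · exact ih h.2 hx

lemma ChainFrom.sub_subset_orth {S : Set V} (hS : R.SupportClosed S) {b : V} {t : List V}
    (h : R.ChainFrom S (b :: t)) {x : V} (hx : x ∈ t) : R.sub x ⊆ R.orth b := by
  induction t generalizing S b with
  | nil => simp at hx
  | cons c t ih =>
    have hS' := h.1.supportClosed_orth hS
    have hc := RootSystemData.sub_subset_orth hS' h.2.1.mem h.2.1.pos
    rcases List.mem_cons.1 hx with rfl | hx
    · exact hc
    · exact ((ih hS' h.2 hx).trans fun y hy => hy.1).trans hc

lemma ChainFrom.last_mem {S : Set V} (hS : R.SupportClosed S) {l : List V} {β : V}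
    (h : R.ChainFrom S (l ++ [β])) : ∀ γ ∈ l, β ∈ R.orth γ := by
  induction l generalizing S with
  | nil => simp
  | cons b l ih =>
    intro γ hγ
    rcases List.mem_cons.1 hγ with rfl | hγ
    · exact ChainFrom.sub_subset_orth hS h (x := β) (by simp)
        (mem_sub_self (h.mem_pos (by simp)))
    · exact ih (h.1.supportClosed_orth hS) h.2 γ hγ

/-- The chain cascade ending in a root of the cascade is its associated chain cascade. -/
lemma exists_isCascadeChainOf {β : V} (hβ : β ∈ R.cascade) :
    ∃ l, R.ChainFrom R.Δ (l ++ [β]) ∧ R.IsCascadeChainOf β (l ++ [β]) := by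
  obtain ⟨l, hl, hmem⟩ := hβ
  obtain ⟨p, q, rfl⟩ := List.append_of_mem hmem
  have hl' := (isChainCascade_iff.1 hl).2
  rw [← List.singleton_append, ← List.append_assoc] at hl'
  have hp := hl'.of_append
  have hpos : β ∈ R.Pos := hp.mem_pos (by simp)
  have hlast := hp.last_mem supportClosed_roots
  refine ⟨p, hp, isChainCascade_iff.2 ⟨by simp, hp⟩, ?_, ?_, ?_⟩
  · intro γ hγ
    rcases List.mem_append.1 hγ with hγ | hγ
    · exact (hlast γ hγ).1
    · rw [List.mem_singleton.1 hγ]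
      exact mem_sub_self hpos
  · rw [List.dropLast_concat]
    exact fun γ hγ => (hlast γ hγ).2
  · rw [List.getLast?_concat]
    rintro γ ⟨⟩
    exact inner_self_pos_of_mem (R.pos_subset hpos)

lemma ChainFrom.sub_subset_span {S : Set V} (hS : R.SupportClosed S) {b : V} {t : List V}
    (h : R.ChainFrom S (b :: t)) {x : V} (hx : x ∈ b :: t) :
    R.sub x ⊆ Submodule.span ℝ (R.support b) := by
  intro φ hφ
  rcases List.mem_cons.1 hx with rfl | hx
  · exact hφ.2
  · exact (h.sub_subset_orth hS hx hφ).1.2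

/-- Two chains of which neither extends the other end in roots with orthogonal supports. -/
lemma ChainFrom.orthogonal {S : Set V} (hS : R.SupportClosed S) {l l' : List V} {β β' : V}
    (h : R.ChainFrom S (l ++ [β])) (h' : R.ChainFrom S (l' ++ [β']))
    (hn : ¬ l ++ [β] <+: l' ++ [β']) (hn' : ¬ l' ++ [β'] <+: l ++ [β]) :
    ∃ T T' : Set V, T ⊆ R.Simple ∧ T' ⊆ R.Simple ∧ (∀ a ∈ T, ∀ b ∈ T', ⟪a, b⟫_ℝ = 0) ∧
      (∀ φ ∈ R.sub β, φ ∈ Submodule.span ℝ T) ∧ ∀ ψ ∈ R.sub β', ψ ∈ Submodule.span ℝ T' := by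
  induction l generalizing S l' with
  | nil =>
    obtain ⟨b', t', hb'⟩ := List.exists_cons_of_ne_nil (List.append_ne_nil_of_right_ne_nil l'
      (List.cons_ne_nil β' []))
    have hmem : β' ∈ b' :: t' := by simp [← hb']
    rw [hb'] at h' hn hn'
    have hne : β ≠ b' := fun e => hn (by simp [e])
    exact ⟨R.support β, R.support b', support_subset_simple _, support_subset_simple _,
      h.1.support_orthogonal hS h'.1 hne, fun φ hφ => hφ.2,
      fun ψ hψ => h'.sub_subset_span hS hmem hψ⟩
  | cons b t ih =>
    by_cases hhead : ∃ t', l' = b :: t'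
    · obtain ⟨t', rfl⟩ := hhead
      exact ih (h.1.supportClosed_orth hS) h.2 h'.2 (fun e => hn (by simpa using e))
        fun e => hn' (by simpa using e)
    · obtain ⟨b', t', hb'⟩ := List.exists_cons_of_ne_nil (List.append_ne_nil_of_right_ne_nil l'
        (List.cons_ne_nil β' []))
      have hmem : β' ∈ b' :: t' := by simp [← hb']
      have hne : b ≠ b' := by
        rintro rfl
        cases l' with
        | nil => exact hn' (by simp_all)
        | cons c u => exact hhead ⟨u, by simp_all⟩
      rw [hb'] at h'
      exact ⟨R.support b, R.support b', support_subset_simple _, support_subset_simple _,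
        h.1.support_orthogonal hS h'.1 hne, fun φ hφ => h.sub_subset_span hS (by simp) hφ,
        fun ψ hψ => h'.sub_subset_span hS hmem hψ⟩

end RootSystemData

/-- If `β, β′ ∈ ℬ` are distinct and neither of the chain cascades `C(β)`,
`C(β′)` is an initial segment (subchain) of the other, then `Δ(β)` and `Δ(β′)` are totally
disjoint: every root of `Δ(β)` is strongly orthogonal to every root of `Δ(β′)`; in
particular `β` and `β′` are strongly orthogonal. -/
theorem statement5 {V : Type*} [NormedAddCommGroup V] [InnerProductSpace ℝ V]
    (R : RootSystemData V) (β β' : V) (hβ : β ∈ R.cascade) (hβ' : β' ∈ R.cascade)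
    (hne : β ≠ β')
    (hnotsub : ∀ l l' : List V, R.IsCascadeChainOf β l → R.IsCascadeChainOf β' l' →
      ¬ l <+: l' ∧ ¬ l' <+: l) :
    (∀ φ ∈ R.sub β, ∀ ψ ∈ R.sub β', R.StronglyOrth φ ψ) ∧ R.StronglyOrth β β' := by
  obtain ⟨l, hl, hlc⟩ := RootSystemData.exists_isCascadeChainOf hβ
  obtain ⟨l', hl', hlc'⟩ := RootSystemData.exists_isCascadeChainOf hβ'
  obtain ⟨hn, hn'⟩ := hnotsub _ _ hlc hlc'
  obtain ⟨T, T', hT, hT', horth, hβT, hβT'⟩ :=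
    hl.orthogonal RootSystemData.supportClosed_roots hl' hn hn'
  have hall : ∀ φ ∈ R.sub β, ∀ ψ ∈ R.sub β', R.StronglyOrth φ ψ := fun φ hφ ψ hψ =>
    RootSystemData.stronglyOrth_of_mem_span hT hT' horth (hβT φ hφ) (hβT' ψ hψ) hφ.1 hψ.1
  exact ⟨hall, hall β (RootSystemData.mem_sub_self (hl.mem_pos (by simp)))
    β' (RootSystemData.mem_sub_self (hl'.mem_pos (by simp)))⟩
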